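/- Let K be a field and A = ⊕_{k∈ℕ} A_k a commutative ℕ-graded K-algebra which is generated, as a K-algebra, by finitely many homogeneous elements of positive degree. Let F be a submultiplicative filtration on A. Then there exists C > 0 such that F^{-Ck} A_k = A_k for all k ≥ 1. -/

import Mathlib

/-- For a commutative ℕ-graded `K`-algebra `A` generated, as a `K`-algebra, by
finitely many homogeneous elements of positive degree, any submultiplicative filtration `F`
on `A` satisfies `F^{-Ck} A_k = A_k` for some `C > 0` and all `k ≥ 1`. -/
theorem stmt5 (K A : Type*) [Field K] [CommRing A] [Algebra K A]
    (𝒜 : ℕ → Submodule K A) [GradedAlgebra 𝒜]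
    (hfg : ∃ s : Finset A, (∀ x ∈ s, ∃ d : ℕ, 1 ≤ d ∧ x ∈ 𝒜 d) ∧
      Algebra.adjoin K (s : Set A) = ⊤)
    (F : ℕ → ℝ → Submodule K A)
    (hFle : ∀ k t, F k t ≤ 𝒜 k)
    (hanti : ∀ k, Antitone (F k))
    (hsmall : ∀ k, ∃ t₀ : ℝ, ∀ t ≤ t₀, F k t = 𝒜 k)
    (hbig : ∀ k, ∃ t₁ : ℝ, ∀ t, t₁ ≤ t → F k t = ⊥)
    (hmul : ∀ (t s : ℝ) (k l : ℕ) (x y : A),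
      x ∈ F k t → y ∈ F l s → x * y ∈ F (k + l) (t + s)) :
    ∃ C : ℝ, 0 < C ∧ ∀ k : ℕ, 1 ≤ k → F k (-C * k) = 𝒜 k := by
  obtain ⟨s, hs, hgen⟩ := hfg
  have hev : ∀ᶠ C : ℝ in Filter.atTop, ∀ x ∈ s, ∃ d : ℕ, 1 ≤ d ∧ x ∈ F d (-C * d) := by
    rw [Filter.eventually_all_finset]
    intro x hx
    obtain ⟨d, hd, hxd⟩ := hs x hx
    obtain ⟨t₀, ht₀⟩ := hsmall d
    filter_upwards [Filter.eventually_ge_atTop |t₀|] with C hC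
    refine ⟨d, hd, ?_⟩
    have hd' : (1 : ℝ) ≤ d := by exact_mod_cast hd
    rw [ht₀ _ (by nlinarith [neg_abs_le t₀, abs_nonneg t₀])]
    exact hxd
  obtain ⟨C, hC, hCpos⟩ := (hev.and (Filter.eventually_gt_atTop 0)).exists
  refine ⟨C, hCpos, fun k hk => le_antisymm (hFle _ _) fun a ha => ?_⟩
  have hmon : ∀ m ∈ Submonoid.closure (s : Set A),
      m = 1 ∨ ∃ d : ℕ, 1 ≤ d ∧ m ∈ F d (-C * d) := by
    intro m hm
    induction hm using Submonoid.closure_induction with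
    | mem x hx => exact Or.inr (hC x hx)
    | one => exact Or.inl rfl
    | mul x y _ _ ihx ihy =>
      rcases ihx with rfl | ⟨d, hd, hxd⟩
      · simpa using ihy
      rcases ihy with rfl | ⟨e, he, hye⟩
      · exact Or.inr ⟨d, hd, by simpa using hxd⟩
      · refine Or.inr ⟨d + e, by omega, ?_⟩
        have h := hmul _ _ _ _ _ _ hxd hye
        rwa [← mul_add, ← Nat.cast_add] at h
  have hspan : Submodule.span K (Submonoid.closure (s : Set A) : Set A) ≤
      (F k (-C * k)).comap (GradedAlgebra.proj 𝒜 k) := by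
    rw [Submodule.span_le]
    intro m hm
    simp only [Submodule.comap_coe, Set.mem_preimage, SetLike.mem_coe, GradedAlgebra.proj_apply]
    rcases hmon m hm with rfl | ⟨d, hd, hmd⟩
    · rw [DirectSum.decompose_of_mem_ne 𝒜 SetLike.GradedOne.one_mem (by omega : 0 ≠ k)]
      exact zero_mem _
    · by_cases hdk : d = k
      · subst hdk
        rwa [DirectSum.decompose_of_mem_same 𝒜 (hFle _ _ hmd)]
      · rw [DirectSum.decompose_of_mem_ne 𝒜 (hFle _ _ hmd) hdk]
        exact zero_mem _
  have hmem : a ∈ Submodule.span K (Submonoid.closure (s : Set A) : Set A) := by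
    rw [← Algebra.adjoin_eq_span, hgen]
    exact Submodule.mem_top
  have h := hspan hmem
  rwa [Submodule.mem_comap, GradedAlgebra.proj_apply,
    DirectSum.decompose_of_mem_same 𝒜 ha] at h
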